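/- For (x, y) ∈ ℝ², let Q_{(x,y)} be the quadratic form on ℝ² given by Q_{(x,y)}(u, v) = (2x² − 2xy + y²)·u² + 2(x² + xy − y²)·uv + (x² + 2xy + 2y²)·v². Define φ: (0, ∞) × ℝ → ℝ² by φ(r, θ) = (r·cos(θ − ln r), r·sin(θ − ln r)). Then for all r > 0, θ ∈ ℝ and all a, b ∈ ℝ: Q_{φ(r,θ)}( a·∂φ/∂r(r, θ) + b·∂φ/∂θ(r, θ) ) = r²·(a² + r²·b²). (This is the verification in Section 3.4 of the paper that the pull-back φ*(g°) of the metric g° = r^{−2}·h equals the model conic metric dr² + r²dθ², where h is the singular metric with quadratic form Q; note |φ(r, θ)| = r.) -/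

import Mathlib

/-- The quadratic form of the singular Riemannian metric
`h = [2x² − 2xy + y²]dx² + 2[x² + xy − y²]dx dy + [x² + 2xy + 2y²]dy²`
at the base point `p ∈ ℝ²`, evaluated on the vector `w ∈ ℝ²`. -/
def Qform (p w : ℝ × ℝ) : ℝ :=
  (2 * p.1 ^ 2 - 2 * p.1 * p.2 + p.2 ^ 2) * w.1 ^ 2 +
    2 * (p.1 ^ 2 + p.1 * p.2 - p.2 ^ 2) * (w.1 * w.2) +
    (p.1 ^ 2 + 2 * p.1 * p.2 + 2 * p.2 ^ 2) * w.2 ^ 2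

/-- `φ(r, θ) = (r·cos(θ − ln r), r·sin(θ − ln r))`. -/
noncomputable def phi (r θ : ℝ) : ℝ × ℝ :=
  (r * Real.cos (θ - Real.log r), r * Real.sin (θ - Real.log r))

/-!
Statement 8 (Section 3.4 of the paper): the pull-back of the singular metric `h`
(with quadratic form `Q`) by `φ` is `r²(dr² + r²dθ²)`, i.e. for all `r > 0`, `θ`
and all `a, b ∈ ℝ`,
`Q_{φ(r,θ)}(a·∂φ/∂r + b·∂φ/∂θ) = r²·(a² + r²·b²)`;
equivalently, `φ*(g°) = dr² + r²dθ²` for `g° = r^{−2}·h`.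
-/
theorem statement_8 (r θ a b : ℝ) (hr : 0 < r) :
    Qform (phi r θ)
        (a • deriv (fun s => phi s θ) r + b • deriv (fun t => phi r t) θ) =
      r ^ 2 * (a ^ 2 + r ^ 2 * b ^ 2) := by
  have hr0 : r ≠ 0 := hr.ne'
  have hin : HasDerivAt (fun s : ℝ => θ - Real.log s) (-r⁻¹) r :=
    (Real.hasDerivAt_log hr0).const_sub θ
  have h1 : HasDerivAt (fun s => phi s θ)
      (1 * Real.cos (θ - Real.log r) + r * (-Real.sin (θ - Real.log r) * (-r⁻¹)),
       1 * Real.sin (θ - Real.log r) + r * (Real.cos (θ - Real.log r) * (-r⁻¹))) r :=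
    ((hasDerivAt_id r).mul hin.cos).prodMk ((hasDerivAt_id r).mul hin.sin)
  have hin2 : HasDerivAt (fun t : ℝ => t - Real.log r) 1 θ :=
    (hasDerivAt_id θ).sub_const _
  have h2 : HasDerivAt (fun t => phi r t)
      (r * (-Real.sin (θ - Real.log r) * 1), r * (Real.cos (θ - Real.log r) * 1)) θ :=
    (hin2.cos.const_mul r).prodMk (hin2.sin.const_mul r)
  rw [h1.deriv, h2.deriv]
  have hcs := Real.sin_sq_add_cos_sq (θ - Real.log r)
  simp only [Qform, phi, Prod.fst_add, Prod.snd_add, Prod.smul_fst, Prod.smul_snd, smul_eq_mul]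
  generalize Real.sin (θ - Real.log r) = s at *
  generalize Real.cos (θ - Real.log r) = c at *
  have e1 : 1 * c + r * (-s * (-r⁻¹)) = c + s := by field_simp
  have e2 : 1 * s + r * (c * (-r⁻¹)) = s - c := by field_simp; ring
  rw [e1, e2]
  have k1 : (r * c) * (a * (c + s) + b * (r * (-s * 1)))
      + (r * s) * (a * (s - c) + b * (r * (c * 1))) = r * a := by
    linear_combination r * a * hcs
  have k2 : -(r * s) * (a * (c + s) + b * (r * (-s * 1)))
      + (r * c) * (a * (s - c) + b * (r * (c * 1))) = r * (r * b - a) := by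
    linear_combination r * (r * b - a) * hcs
  generalize a * (c + s) + b * (r * (-s * 1)) = u at *
  generalize a * (s - c) + b * (r * (c * 1)) = v at *
  have e : r ^ 2 * (a ^ 2 + r ^ 2 * b ^ 2)
      = (r * a) ^ 2 + (r * a + r * (r * b - a)) ^ 2 := by ring
  rw [e, ← k2, ← k1]
  ring
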